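/- Let n ≥ 3 and let Q = I − (1/n)·w w* be the orthogonal projection of ℂⁿ⊗ℂⁿ onto the orthogonal complement of w = Σ_{i=1}^n e_i⊗e_i. Suppose {a_i a_i* ⊗ \bar{b_i} b_iᵀ : i = 1,…,N} is a rank-one separable measurement (i.e., Σ_{i=1}^N a_i a_i* ⊗ \bar{b_i} b_iᵀ = I) such that a_i ⊗ \bar{b_i} and a_j ⊗ \bar{b_j} are linearly independent for all i ≠ j. Then there exist indices i ≠ j such that the operators Q (a_i a_i* ⊗ \bar{b_i} b_iᵀ) Q and Q (a_j a_j* ⊗ \bar{b_j} b_jᵀ) Q do not commute. -/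

import Mathlib

open Matrix Kronecker BigOperators

noncomputable section

/-- The product vector `a ⊗ conj b` in `ℂⁿ ⊗ ℂⁿ ≅ ℂ^{n²}`. -/
def prodVec {n : ℕ} (a b : Fin n → ℂ) : Fin n × Fin n → ℂ :=
  fun p => a p.1 * (starRingEnd ℂ) (b p.2)

/-- The (unnormalized) canonical maximally entangled vector `w = ∑ e_i ⊗ e_i`. -/
def maxEnt (n : ℕ) : Fin n × Fin n → ℂ := fun p => if p.1 = p.2 then 1 else 0

/-- The orthogonal projection `Q = I - (1/n) w w*` onto the orthogonal complement of `w`. -/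
def Qproj (n : ℕ) : Matrix (Fin n × Fin n) (Fin n × Fin n) ℂ :=
  1 - (1 / (n : ℂ)) • Matrix.vecMulVec (maxEnt n) (star (maxEnt n))

/-- The measurement operator `a a* ⊗ conj(b) bᵀ` on `ℂⁿ ⊗ ℂⁿ ≅ ℂ^{n²}`. -/
def meas {n : ℕ} (a b : Fin n → ℂ) : Matrix (Fin n × Fin n) (Fin n × Fin n) ℂ :=
  Matrix.vecMulVec a (star a) ⊗ₖ Matrix.vecMulVec (star b) b

open scoped ComplexOrder in
lemma dss {ι : Type*} [Fintype ι] (x : ι → ℂ) : star x ⬝ᵥ x = 0 ↔ x = 0 :=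
  dotProduct_star_self_eq_zero

lemma meas_eq {n : ℕ} (a b : Fin n → ℂ) :
    meas a b = vecMulVec (prodVec a b) (star (prodVec a b)) := by
  ext p q
  simp [meas, prodVec, vecMulVec_apply, kroneckerMap_apply]
  ring

lemma Q_herm (n : ℕ) : (Qproj n)ᴴ = Qproj n := by
  ext p q
  simp [Qproj, vecMulVec_apply, maxEnt, Matrix.one_apply, eq_comm]
  ring_nf
  split_ifs <;> simp

lemma Q_mulVec (n : ℕ) (v : Fin n × Fin n → ℂ) :
    Qproj n *ᵥ v = v - ((1 / (n : ℂ)) * (star (maxEnt n) ⬝ᵥ v)) • maxEnt n := by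
  rw [Qproj, Matrix.sub_mulVec, Matrix.one_mulVec, Matrix.smul_mulVec, Matrix.vecMulVec_mulVec]
  ext p
  simp
  ring

lemma w_dot (n : ℕ) : star (maxEnt n) ⬝ᵥ maxEnt n = (n : ℂ) := by
  simp [dotProduct, maxEnt, Fintype.sum_prod_type]

lemma Q_w (n : ℕ) (hn : 3 ≤ n) : Qproj n *ᵥ maxEnt n = 0 := by
  have : (n : ℂ) ≠ 0 := by exact_mod_cast (by omega : n ≠ 0)
  rw [Q_mulVec, w_dot]
  simp [this]

lemma QmQ {n : ℕ} (a b : Fin n → ℂ) : Qproj n * meas a b * Qproj n =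
    vecMulVec (Qproj n *ᵥ prodVec a b) (star (Qproj n *ᵥ prodVec a b)) := by
  rw [meas_eq, Matrix.mul_vecMulVec, Matrix.vecMulVec_mul, Matrix.star_mulVec, Q_herm]

/-- Commuting rank-one positive operators: orthogonal or parallel. -/
lemma orth_or_par {ι : Type*} [Fintype ι] (u x : ι → ℂ)
    (h : vecMulVec u (star u) * vecMulVec x (star x)
      = vecMulVec x (star x) * vecMulVec u (star u)) :
    star u ⬝ᵥ x = 0 ∨ ∃ c : ℂ, u = c • x := by
  by_cases h0 : star u ⬝ᵥ x = 0
  · exact Or.inl h0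
  right
  have hx : star x ⬝ᵥ x ≠ 0 := by
    intro hx
    rw [dss] at hx
    exact h0 (by simp [hx])
  have h1 := congrArg (fun M => M *ᵥ x) h
  simp only [← Matrix.mulVec_mulVec, Matrix.vecMulVec_mulVec] at h1
  refine ⟨(star x ⬝ᵥ u) * (star x ⬝ᵥ x)⁻¹, ?_⟩
  ext p
  have h2 := congrFun h1 p
  simp at h2
  have h3 : (star u ⬝ᵥ x) * ((star x ⬝ᵥ x) * u p - (star x ⬝ᵥ u) * x p) = 0 := by
    linear_combination h2
  have h4 := (mul_eq_zero.mp h3).resolve_left h0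
  simp only [Pi.smul_apply, smul_eq_mul]
  field_simp
  linear_combination h4

lemma par_contra {n : ℕ} (hn : 3 ≤ n) (a b a' b' : Fin n → ℂ) (c s : ℂ)
    (h : prodVec a b - c • prodVec a' b' = s • maxEnt n) : s = 0 := by
  have e : ∀ p q : Fin n, a p * (starRingEnd ℂ) (b q) - c * (a' p * (starRingEnd ℂ) (b' q))
      = s * (if p = q then 1 else 0) := fun p q => by
    simpa [prodVec, maxEnt] using congrFun h (p, q)
  let i : Fin n := ⟨0, by omega⟩
  let j : Fin n := ⟨1, by omega⟩
  let k : Fin n := ⟨2, by omega⟩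
  have hij : i ≠ j := by simp [i, j]
  have hik : i ≠ k := by simp [i, k]
  have hjk : j ≠ k := by simp [j, k]
  have hdet : ∀ x y : Fin n → ℂ, ∀ M : Fin n → Fin n → ℂ,
      (∀ p q, M p q = a p * (starRingEnd ℂ) (b q) - c * (a' p * (starRingEnd ℂ) (b' q))) →
      M i i * (M j j * M k k - M j k * M k j) - M i j * (M j i * M k k - M j k * M k i)
        + M i k * (M j i * M k j - M j j * M k i) = 0 := by
    intro x y M hM
    simp only [hM]
    ring
  have := hdet a b (fun p q => s * (if p = q then 1 else 0)) (fun p q => (e p q).symm)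
  simp [hij, hik, hjk, hij.symm, hik.symm, hjk.symm] at this
  exact this

theorem stmt1 (n N : ℕ) (hn : 3 ≤ n) (a b : Fin N → (Fin n → ℂ))
    (hsum : ∑ i, meas (a i) (b i) = (1 : Matrix (Fin n × Fin n) (Fin n × Fin n) ℂ))
    (hli : ∀ i j : Fin N, i ≠ j →
      LinearIndependent ℂ ![prodVec (a i) (b i), prodVec (a j) (b j)]) :
    ∃ i j : Fin N, i ≠ j ∧
      (Qproj n * meas (a i) (b i) * Qproj n) * (Qproj n * meas (a j) (b j) * Qproj n)
        ≠ (Qproj n * meas (a j) (b j) * Qproj n) * (Qproj n * meas (a i) (b i) * Qproj n) := by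
  by_contra hcon
  push Not at hcon
  have horth : ∀ i j, i ≠ j →
      star (Qproj n *ᵥ prodVec (a i) (b i)) ⬝ᵥ (Qproj n *ᵥ prodVec (a j) (b j)) = 0 := by
    intro i j hij
    have h := hcon i j hij
    rw [QmQ, QmQ] at h
    rcases orth_or_par _ _ h with h | ⟨c, hc⟩
    · exact h
    exfalso
    rw [Q_mulVec, Q_mulVec] at hc
    obtain ⟨s, hs⟩ : ∃ s : ℂ, prodVec (a i) (b i) - c • prodVec (a j) (b j) = s • maxEnt n := by
      refine ⟨1 / (n : ℂ) * (star (maxEnt n) ⬝ᵥ prodVec (a i) (b i))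
        - c * (1 / (n : ℂ) * (star (maxEnt n) ⬝ᵥ prodVec (a j) (b j))), ?_⟩
      rw [sub_smul, mul_smul c]
      rw [smul_sub] at hc
      linear_combination hc
    have hs0 := par_contra hn _ _ _ _ c s hs
    have := LinearIndependent.pair_iff.mp (hli i j hij) 1 (-c) (by
      rw [hs0] at hs
      simpa [sub_eq_add_neg] using hs)
    exact one_ne_zero this.1
  have hw : ∑ i, (star (prodVec (a i) (b i)) ⬝ᵥ maxEnt n) • prodVec (a i) (b i) = maxEnt n := by
    have := congrArg (fun M => M *ᵥ maxEnt n) hsum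
    simpa [Matrix.sum_mulVec, meas_eq, Matrix.vecMulVec_mulVec] using this
  have hw0 : ∑ i, (star (prodVec (a i) (b i)) ⬝ᵥ maxEnt n) •
      (Qproj n *ᵥ prodVec (a i) (b i)) = 0 := by
    rw [← Q_w n hn]
    conv_rhs => rw [← hw, Matrix.mulVec_sum]
    simp only [Matrix.mulVec_smul]
  have ht : ∀ j, star (prodVec (a j) (b j)) ⬝ᵥ maxEnt n = 0 := by
    intro j
    have h1 := congrArg (fun x => star (Qproj n *ᵥ prodVec (a j) (b j)) ⬝ᵥ x) hw0
    simp only [dotProduct_sum, dotProduct_smul, dotProduct_zero] at h1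
    rw [Finset.sum_eq_single j (fun i _ hi => by rw [horth j i hi.symm, smul_zero])
      (fun h => absurd (Finset.mem_univ j) h), smul_eq_mul] at h1
    rcases mul_eq_zero.mp h1 with h1 | h1
    · exact h1
    rw [dss, Q_mulVec, sub_eq_zero] at h1
    have hs0 := par_contra hn (a j) (b j) 0 0 0 _ (by rw [zero_smul, sub_zero]; exact h1)
    rw [h1, hs0]
    simp
  simp only [ht, zero_smul, Finset.sum_const_zero] at hw
  have := w_dot n
  have h0 : (n : ℂ) ≠ 0 := by exact_mod_cast (by omega : n ≠ 0)
  rw [← hw, dotProduct_zero] at this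
  exact h0 this.symm
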